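/- arXiv:2210.08106 — 8 statements merged into one kernel-verified Lean document; each statement's English description precedes it below -/
import Mathlib

section
/- Let ρ and G be real numbers with 0 < ρ ≤ 1 and G > 0, and let e : ℕ → ℝ be a nonnegative sequence such that for every t ≥ 1 and every s ∈ [0,1], e(t) ≤ (1 − s·ρ)·e(t−1) + s²·ρ·G. Then for every natural number t₀ satisfying t₀ ≥ (1/ρ)·ln(e(0)/G) (any t₀ ≥ 0 if e(0) ≤ G) and every t ≥ t₀, one has e(t) ≤ 2G / (1 + (ρ/2)·(t − t₀)). -/
/-- Unrolling `e (n + 1) ≤ (1 - ρ) * e n + ρ * G`. -/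
theorem le_add_pow_mul_of_contraction {ρ G : ℝ} (hρ1 : ρ ≤ 1) (hG : 0 ≤ G)
    {e : ℕ → ℝ} (h : ∀ n, e (n + 1) ≤ (1 - ρ) * e n + ρ * G) (n : ℕ) :
    e n ≤ G + (1 - ρ) ^ n * e 0 := by
  induction n with
  | zero => simpa using hG
  | succ n ih =>
    have := mul_le_mul_of_nonneg_left ih (sub_nonneg.2 hρ1)
    rw [pow_succ]
    linarith [h n]

theorem one_sub_pow_mul_le_of_log_le {ρ G a : ℝ} (hρ0 : 0 < ρ) (hρ1 : ρ ≤ 1) (hG : 0 < G)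
    (ha : 0 ≤ a) {n : ℕ} (hn : (1 / ρ) * Real.log (a / G) ≤ n) :
    (1 - ρ) ^ n * a ≤ G := by
  rcases ha.eq_or_lt with rfl | ha
  · simpa using hG.le
  have hlog : Real.log (a / G) ≤ n * ρ := by
    rwa [one_div, inv_mul_eq_div, div_le_iff₀ hρ0] at hn
  have hle : a ≤ Real.exp (n * ρ) * G :=
    (div_le_iff₀ hG).1 ((Real.log_le_iff_le_exp (div_pos ha hG)).1 hlog)
  have hpow : (1 - ρ) ^ n ≤ Real.exp (-(n * ρ)) := by
    rw [← mul_neg, Real.exp_nat_mul]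
    exact pow_le_pow_left₀ (sub_nonneg.2 hρ1) (Real.one_sub_le_exp_neg ρ) n
  calc (1 - ρ) ^ n * a ≤ Real.exp (-(n * ρ)) * (Real.exp (n * ρ) * G) := by gcongr
    _ = G := by rw [← mul_assoc, ← Real.exp_add]; simp

/-- The bound obtained from `x ≤ 2 * G / D` with step parameter `s = 1 / D`. -/
theorem step_le_two_mul_div_add {ρ G D x : ℝ} (hρ0 : 0 ≤ ρ) (hρ1 : ρ ≤ 1) (hG : 0 ≤ G)
    (hD : 1 ≤ D) (hx : x ≤ 2 * G / D) :
    (1 - 1 / D * ρ) * x + (1 / D) ^ 2 * ρ * G ≤ 2 * G / (D + ρ / 2) := by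
  have hD0 : 0 < D := by linarith
  have hs : 0 ≤ 1 - 1 / D * ρ := by
    rw [one_div_mul_eq_div, sub_nonneg, div_le_one hD0]
    linarith
  calc (1 - 1 / D * ρ) * x + (1 / D) ^ 2 * ρ * G
      ≤ (1 - 1 / D * ρ) * (2 * G / D) + (1 / D) ^ 2 * ρ * G := by gcongr
    _ = 2 * G * (D - ρ / 2) / D ^ 2 := by field_simp; ring
    _ ≤ 2 * G / (D + ρ / 2) := by
      rw [div_le_div_iff₀ (by positivity) (by positivity)]
      nlinarith [mul_nonneg hG (sq_nonneg ρ)]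


/-- Analytic core of Theorems 2 and 3: a per-iteration recurrence
`e t ≤ (1 - s·ρ)·e (t-1) + s²·ρ·G`, valid for all `s ∈ [0,1]`, implies `O(1/t)` decay. -/
theorem stmt0 (ρ G : ℝ) (hρ0 : 0 < ρ) (hρ1 : ρ ≤ 1) (hG : 0 < G)
    (e : ℕ → ℝ) (he : ∀ t, 0 ≤ e t)
    (hrec : ∀ t : ℕ, 1 ≤ t → ∀ s ∈ Set.Icc (0 : ℝ) 1,
      e t ≤ (1 - s * ρ) * e (t - 1) + s ^ 2 * ρ * G)
    (t₀ : ℕ) (ht₀ : (1 / ρ) * Real.log (e 0 / G) ≤ (t₀ : ℝ)) :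
    ∀ t : ℕ, t₀ ≤ t → e t ≤ 2 * G / (1 + (ρ / 2) * ((t : ℝ) - (t₀ : ℝ))) := by
  intro t ht
  induction t, ht using Nat.le_induction with
  | base =>
    have h := le_add_pow_mul_of_contraction hρ1 hG.le
      (fun n => by simpa using hrec (n + 1) (by simp) 1 (by simp)) t₀
    have h' := one_sub_pow_mul_le_of_log_le hρ0 hρ1 hG (he 0) ht₀
    simp only [sub_self, mul_zero, add_zero, div_one]
    linarith
  | succ t ht ih =>
    have htt : (t₀ : ℝ) ≤ t := by exact_mod_cast ht
    have hD : 1 ≤ 1 + (ρ / 2) * ((t : ℝ) - t₀) :=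
      le_add_of_nonneg_right (mul_nonneg (by linarith) (by linarith))
    have hs : 1 / (1 + (ρ / 2) * ((t : ℝ) - t₀)) ∈ Set.Icc (0 : ℝ) 1 :=
      ⟨by positivity, (div_le_one (by linarith)).2 hD⟩
    have h := hrec (t + 1) (by simp) _ hs
    rw [Nat.add_sub_cancel] at h
    refine (h.trans (step_le_two_mul_div_add hρ0.le hρ1 hG.le hD ih)).trans_eq ?_
    congr 1
    push_cast
    ring
end

section
/- Let h ∈ (0,1] and G ≥ 0 be real numbers and C ≥ 2 a natural number. Let e : ℕ → ℝ be a nonnegative sequence such that for every natural number t ≥ C, e(t) ≤ (1 − h/t)·e(t−1) + h·G/(t − C + 1)². Then for every t ≥ C, e(t) ≤ (C^h · e(C−1) + h·G·(C+1)·(ln(t − C + 1) + 1)) / t^h. -/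
/-- Bernoulli's inequality for exponents in `[0, 1]`, as a contraction estimate. -/
theorem add_one_rpow_mul_one_sub_div_le {h x : ℝ} (hh0 : 0 ≤ h) (hh1 : h ≤ 1) (hx : 1 ≤ x) :
    (x + 1) ^ h * (1 - h / x) ≤ x ^ h := by
  have hx0 : 0 < x := by linarith
  have hb : (1 + 1 / x) ^ h ≤ 1 + h * (1 / x) :=
    rpow_one_add_le_one_add_mul_self (by have := one_div_pos.2 hx0; linarith) hh0 hh1
  have hsplit : (x + 1) ^ h = x ^ h * (1 + 1 / x) ^ h := by
    rw [← Real.mul_rpow hx0.le (by positivity)]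
    congr 1
    field_simp
  have hq : h / x ≤ 1 := by rw [div_le_one hx0]; linarith
  have hprod : (1 + 1 / x) ^ h * (1 - h / x) ≤ 1 :=
    calc (1 + 1 / x) ^ h * (1 - h / x) ≤ (1 + h * (1 / x)) * (1 - h / x) :=
          mul_le_mul_of_nonneg_right hb (by linarith)
      _ = 1 - (h / x) ^ 2 := by ring
      _ ≤ 1 := by linarith [sq_nonneg (h / x)]
  rw [hsplit, mul_assoc]
  exact mul_le_of_le_one_right (Real.rpow_nonneg hx0.le h) hprod

theorem add_rpow_div_sq_le {h s c : ℝ} (hh1 : h ≤ 1) (hs : 1 ≤ s) (hc : 0 ≤ c) :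
    (s + c) ^ h / s ^ 2 ≤ (c + 1) / s := by
  have hs0 : 0 < s := by linarith
  have hle : (s + c) ^ h ≤ s + c := by
    simpa using Real.rpow_le_rpow_of_exponent_le (show 1 ≤ s + c by linarith) hh1
  rw [div_le_div_iff₀ (by positivity) hs0]
  have hlin : s + c ≤ s * (c + 1) := by nlinarith
  calc (s + c) ^ h * s ≤ s * (c + 1) * s := mul_le_mul_of_nonneg_right (hle.trans hlin) hs0.le
    _ = (c + 1) * s ^ 2 := by ring

theorem one_div_add_one_le_log_sub_log {x : ℝ} (hx : 0 < x) :
    1 / (x + 1) ≤ Real.log (x + 1) - Real.log x := by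
  have hlog := Real.one_sub_inv_le_log_of_pos (show 0 < (x + 1) / x by positivity)
  rw [Real.log_div (by positivity) hx.ne'] at hlog
  convert hlog using 1
  field_simp
  ring

/-- Analytic core of Theorem 4 (vertical FL with cyclic client participation):
the recurrence `e t ≤ (1 - h/t)·e (t-1) + h·G/(t-C+1)²` implies
`e t ≤ (C^h·e(C-1) + h·G·(C+1)·(ln(t-C+1)+1)) / t^h`. -/
theorem stmt1 (h G : ℝ) (hh0 : 0 < h) (hh1 : h ≤ 1) (hG : 0 ≤ G)
    (C : ℕ) (hC : 2 ≤ C)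
    (e : ℕ → ℝ) (he : ∀ t, 0 ≤ e t)
    (hrec : ∀ t : ℕ, C ≤ t →
      e t ≤ (1 - h / (t : ℝ)) * e (t - 1) + h * G / ((t : ℝ) - (C : ℝ) + 1) ^ 2) :
    ∀ t : ℕ, C ≤ t →
      e t ≤ ((C : ℝ) ^ h * e (C - 1)
          + h * G * ((C : ℝ) + 1) * (Real.log ((t : ℝ) - (C : ℝ) + 1) + 1)) / (t : ℝ) ^ h := by
  have step : ∀ n : ℕ, ((C : ℝ) + n + 1) ^ h * e (C + n) ≤
      ((C : ℝ) + n) ^ h * e (C + n - 1) + h * G * (((C : ℝ) + 1) / ((n : ℝ) + 1)) := by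
    intro n
    have hC' : (2 : ℝ) ≤ C := by exact_mod_cast hC
    have hn : (0 : ℝ) ≤ n := n.cast_nonneg
    have hr := hrec (C + n) (Nat.le_add_right C n)
    push_cast at hr
    rw [add_sub_cancel_left] at hr
    have hcontr := mul_le_mul_of_nonneg_right
      (add_one_rpow_mul_one_sub_div_le hh0.le hh1 (show 1 ≤ (C : ℝ) + n by linarith))
      (he (C + n - 1))
    have hnoise := mul_le_mul_of_nonneg_left
      (add_rpow_div_sq_le (s := (n : ℝ) + 1) (c := C) hh1 (by linarith) (by linarith))
      (mul_nonneg hh0.le hG)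
    rw [show (n : ℝ) + 1 + C = C + n + 1 by ring] at hnoise
    calc ((C : ℝ) + n + 1) ^ h * e (C + n)
        ≤ ((C : ℝ) + n + 1) ^ h *
          ((1 - h / ((C : ℝ) + n)) * e (C + n - 1) + h * G / ((n : ℝ) + 1) ^ 2) :=
          mul_le_mul_of_nonneg_left hr (by positivity)
      _ = ((C : ℝ) + n + 1) ^ h * (1 - h / ((C : ℝ) + n)) * e (C + n - 1)
          + h * G * (((C : ℝ) + n + 1) ^ h / ((n : ℝ) + 1) ^ 2) := by ring
      _ ≤ _ := add_le_add hcontr hnoise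
  have weighted : ∀ n : ℕ, ((C : ℝ) + n + 1) ^ h * e (C + n) ≤
      (C : ℝ) ^ h * e (C - 1) + h * G * ((C : ℝ) + 1) * (Real.log ((n : ℝ) + 1) + 1) := by
    intro n
    induction n with
    | zero => simpa [mul_assoc] using step 0
    | succ k ih =>
      have hs := step (k + 1)
      have hlog := mul_le_mul_of_nonneg_left
        (one_div_add_one_le_log_sub_log (show (0 : ℝ) < (k : ℝ) + 1 by positivity))
        (show 0 ≤ h * G * ((C : ℝ) + 1) by positivity)
      rw [show C + (k + 1) - 1 = C + k by omega] at hs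
      push_cast at hs ⊢
      rw [← add_assoc (C : ℝ) (k : ℝ) 1] at hs ⊢
      rw [show h * G * (((C : ℝ) + 1) / ((k : ℝ) + 1 + 1))
        = h * G * ((C : ℝ) + 1) * (1 / ((k : ℝ) + 1 + 1)) by ring] at hs
      linarith
  intro t ht
  obtain ⟨n, rfl⟩ := Nat.exists_eq_add_of_le ht
  have hpos : (0 : ℝ) < (C : ℝ) + n := by
    have : 0 < C + n := by omega
    exact_mod_cast this
  push_cast
  rw [add_sub_cancel_left, le_div_iff₀ (Real.rpow_pos_of_pos hpos h), mul_comm]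
  exact (mul_le_mul_of_nonneg_right
    (Real.rpow_le_rpow hpos.le (by linarith) hh0.le) (he _)).trans (weighted n)
end

section
/- In the regularized ERM setting, let each l_i be convex and let α ∈ ℝ^N be such that each conjugate value l_i*(−α_i) is finite (the defining supremum is bounded above). Set w = (1/(λN))·∑_{i=1}^N α_i x_i and z_i = ⟨x_i, w⟩, and for each i let u_i ∈ ℝ be such that −u_i is a subgradient of l_i at z_i (i.e., l_i(y) ≥ l_i(z_i) − u_i·(y − z_i) for all y ∈ ℝ). Then for every s ∈ [0,1], the vector α' = α + s·(u − α) satisfies D(α') − D(α) ≥ s·(P(w) − D(α)) − (s²/(2λN))·∑_{i=1}^N (u_i − α_i)². -/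
open scoped RealInnerProductSpace

/-- Convex conjugate `l*(a) = sup_z (a·z − l(z))` (as a real-valued supremum). -/
noncomputable def conj (l : ℝ → ℝ) (a : ℝ) : ℝ := ⨆ z : ℝ, a * z - l z

/-- Primal objective `P(w) = (λ/2)‖w‖² + (1/N)∑ l_i(⟨x_i,w⟩)`. -/
noncomputable def primal {E : Type*} [NormedAddCommGroup E] [InnerProductSpace ℝ E]
    (N : ℕ) (x : Fin N → E) (l : Fin N → ℝ → ℝ) (lam : ℝ) (w : E) : ℝ :=
  lam / 2 * ‖w‖ ^ 2 + (1 / (N : ℝ)) * ∑ i, l i ⟪x i, w⟫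

/-- Dual objective `D(α) = −(λ/2)‖(1/(λN))∑ α_i x_i‖² − (1/N)∑ l_i*(−α_i)`. -/
noncomputable def dual {E : Type*} [NormedAddCommGroup E] [InnerProductSpace ℝ E]
    (N : ℕ) (x : Fin N → E) (l : Fin N → ℝ → ℝ) (lam : ℝ) (α : Fin N → ℝ) : ℝ :=
  -(lam / 2) * ‖(1 / (lam * (N : ℝ))) • ∑ i, α i • x i‖ ^ 2
    - (1 / (N : ℝ)) * ∑ i, conj (l i) (-(α i))

/-- A subgradient `-u` of `l` at `z` bounds the conjugate along the segment from `-a` to `-u`. -/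
theorem conj_segment_le {l : ℝ → ℝ} {a u z s : ℝ}
    (hfin : BddAbove (Set.range fun y : ℝ => (-a) * y - l y))
    (hu : ∀ y : ℝ, l y ≥ l z - u * (y - z)) (hs : s ∈ Set.Icc (0 : ℝ) 1) :
    conj l (-(a + s * (u - a))) ≤ (1 - s) * conj l (-a) + s * (-u * z - l z) := by
  refine ciSup_le fun y => ?_
  have h₁ : -a * y - l y ≤ conj l (-a) := le_ciSup hfin y
  have h₂ : -u * y - l y ≤ -u * z - l z := by linarith [hu y]
  have h₃ := mul_le_mul_of_nonneg_left h₁ (sub_nonneg.2 hs.2)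
  have h₄ := mul_le_mul_of_nonneg_left h₂ hs.1
  linarith

theorem norm_sum_smul_sq_le {E : Type*} [SeminormedAddCommGroup E] [NormedSpace ℝ E]
    {ι : Type*} [Fintype ι] {x : ι → E} (hx : ∀ i, ‖x i‖ ≤ 1) (d : ι → ℝ) :
    ‖∑ i, d i • x i‖ ^ 2 ≤ Fintype.card ι * ∑ i, d i ^ 2 := by
  have h : ‖∑ i, d i • x i‖ ≤ ∑ i, |d i| := norm_sum_le_of_le _ fun i _ => by
    rw [norm_smul, Real.norm_eq_abs]
    exact mul_le_of_le_one_right (abs_nonneg _) (hx i)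
  calc ‖∑ i, d i • x i‖ ^ 2 ≤ (∑ i, |d i|) ^ 2 := by gcongr
    _ ≤ Fintype.card ι * ∑ i, |d i| ^ 2 := sq_sum_le_card_mul_sum_sq
    _ = Fintype.card ι * ∑ i, d i ^ 2 := by simp only [sq_abs]

/-- Deterministic full-update per-iteration improvement inequality (proof of Theorem 1). -/
theorem stmt2 {E : Type*} [NormedAddCommGroup E] [InnerProductSpace ℝ E]
    (N : ℕ) (hN : 1 ≤ N) (x : Fin N → E) (hx : ∀ i, ‖x i‖ ≤ 1)
    (l : Fin N → ℝ → ℝ) (lam : ℝ) (hlam : 0 < lam)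
    (hconv : ∀ i, ConvexOn ℝ Set.univ (l i))
    (α : Fin N → ℝ)
    (hfin : ∀ i, BddAbove (Set.range fun z : ℝ => (-(α i)) * z - l i z))
    (w : E) (hw : w = (1 / (lam * (N : ℝ))) • ∑ i, α i • x i)
    (u : Fin N → ℝ)
    (hu : ∀ i, ∀ y : ℝ, l i y ≥ l i ⟪x i, w⟫ - u i * (y - ⟪x i, w⟫)) :
    ∀ s ∈ Set.Icc (0 : ℝ) 1,
      dual N x l lam (fun i => α i + s * (u i - α i)) - dual N x l lam α ≥
        s * (primal N x l lam w - dual N x l lam α)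
          - (s ^ 2 / (2 * lam * (N : ℝ))) * ∑ i, (u i - α i) ^ 2 := by
  intro s hs
  have hN₀ : (0 : ℝ) < N := by exact_mod_cast hN
  set c : ℝ := 1 / (lam * (N : ℝ)) with hc
  have hinner (b : Fin N → ℝ) : ⟪w, ∑ i, b i • x i⟫ = ∑ i, b i * ⟪x i, w⟫ := by
    simp only [inner_sum, inner_smul_right, real_inner_comm]
  have hw_sq : ‖w‖ ^ 2 = c * ∑ i, α i * ⟪x i, w⟫ := by
    rw [← hinner, ← inner_smul_right, ← hw, real_inner_self_eq_norm_sq]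
  have hw' : c • ∑ i, (α i + s * (u i - α i)) • x i =
      w + (c * s) • ∑ i, (u i - α i) • x i := by
    simp only [hw, add_smul, Finset.sum_add_distrib, smul_add, mul_smul, ← Finset.smul_sum]
  have hw'_sq : ‖c • ∑ i, (α i + s * (u i - α i)) • x i‖ ^ 2 ≤
      ‖w‖ ^ 2 + 2 * (c * s * ∑ i, (u i - α i) * ⟪x i, w⟫) +
        (c * s) ^ 2 * (N * ∑ i, (u i - α i) ^ 2) := by
    have h := norm_sum_smul_sq_le hx fun i => u i - α i
    rw [Fintype.card_fin] at h
    rw [hw', norm_add_sq_real, inner_smul_right, hinner, norm_smul, mul_pow, Real.norm_eq_abs,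
      sq_abs]
    gcongr
  have hconj : ∑ i, conj (l i) (-(α i + s * (u i - α i))) ≤
      (1 - s) * ∑ i, conj (l i) (-(α i)) +
        s * (-∑ i, u i * ⟪x i, w⟫ - ∑ i, l i ⟪x i, w⟫) := by
    calc _ ≤ ∑ i, ((1 - s) * conj (l i) (-(α i)) + s * (-u i * ⟪x i, w⟫ - l i ⟪x i, w⟫)) :=
          Finset.sum_le_sum fun i _ => conj_segment_le (hfin i) (hu i) hs
      _ = _ := by
        simp only [Finset.sum_add_distrib, ← Finset.mul_sum, Finset.sum_sub_distrib, neg_mul,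
          Finset.sum_neg_distrib]
  have hquad := mul_le_mul_of_nonneg_left hw'_sq (half_pos hlam).le
  have hlin := mul_le_mul_of_nonneg_left hconj (one_div_pos.2 hN₀).le
  have hd : ∑ i, (u i - α i) * ⟪x i, w⟫ = ∑ i, u i * ⟪x i, w⟫ - ∑ i, α i * ⟪x i, w⟫ := by
    simp only [sub_mul, Finset.sum_sub_distrib]
  have hlc : lam * c = 1 / N := by rw [hc]; field_simp
  have hcoef : lam / 2 * ((c * s) ^ 2 * N) = s ^ 2 / (2 * lam * N) := by rw [hc]; field_simp
  simp only [dual, primal, ← hc, ← hw]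
  rw [← hcoef]
  rw [hd] at hquad
  rw [← hlc] at hlin ⊢
  linear_combination hquad + hlin + s * lam * hw_sq
end

section
/- In the regularized ERM setting, let each l_i be convex and L-Lipschitz, and let α ∈ ℝ^N satisfy |α_i| ≤ L with each conjugate value l_i*(−α_i) finite. Set w = (1/(λN))·∑_{j=1}^N α_j x_j and z_i = ⟨x_i, w⟩, and for each i let u_i ∈ ℝ be such that −u_i is a subgradient of l_i at z_i. Fix s ∈ [0,1], and for each i let α^{(i)} ∈ ℝ^N agree with α in all coordinates except coordinate i, where α^{(i)}_i = α_i + s·(u_i − α_i). Then (1/N)·∑_{i=1}^N D(α^{(i)}) ≥ D(α) + (s/N)·(P(w) − D(α)) − (s²/N)·(2L²/λ). -/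
open scoped RealInnerProductSpace

theorem conj_le_of_forall_le {l : ℝ → ℝ} {a c : ℝ} (h : ∀ z, a * z - l z ≤ c) :
    conj l a ≤ c :=
  ciSup_le h

/-- Convexity of the conjugate between a point where it is finite and a subgradient `-u` of `l`
at `z₀`, combined with the Fenchel–Young equality at `z₀`. -/
theorem conj_neg_add_mul_sub_le {l : ℝ → ℝ} {a u z₀ s : ℝ}
    (hfin : BddAbove (Set.range fun z : ℝ => -a * z - l z))
    (hu : ∀ y : ℝ, l y ≥ l z₀ - u * (y - z₀)) (hs : s ∈ Set.Icc (0 : ℝ) 1) :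
    conj l (-(a + s * (u - a))) ≤ (1 - s) * conj l (-a) + s * (-u * z₀ - l z₀) := by
  refine conj_le_of_forall_le fun z => ?_
  have h₁ : -a * z - l z ≤ conj l (-a) := le_ciSup hfin z
  have h₂ : -u * z - l z ≤ -u * z₀ - l z₀ := by linarith [hu z]
  have h₃ := mul_le_mul_of_nonneg_left h₁ (sub_nonneg.2 hs.2)
  have h₄ := mul_le_mul_of_nonneg_left h₂ hs.1
  linarith

/-- A subgradient of an `L`-Lipschitz function is bounded by `L`. -/
theorem abs_le_of_lipschitz_of_subgradient {l : ℝ → ℝ} {L u z₀ : ℝ}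
    (hLip : ∀ a b : ℝ, |l a - l b| ≤ L * |a - b|)
    (hu : ∀ y : ℝ, l y ≥ l z₀ - u * (y - z₀)) : |u| ≤ L := by
  have h₁ := (le_abs_self _).trans (hLip (z₀ + 1) z₀)
  have h₂ := (le_abs_self _).trans (hLip (z₀ - 1) z₀)
  have h₃ := hu (z₀ + 1)
  have h₄ := hu (z₀ - 1)
  rw [add_sub_cancel_left, abs_one] at h₁
  rw [sub_sub_cancel_left, abs_neg, abs_one] at h₂
  exact abs_le.2 ⟨by linarith, by linarith⟩

theorem sum_update_apply {ι M : Type*} [Fintype ι] [DecidableEq ι] [AddCommGroup M]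
    (f : ι → ℝ → M) (α : ι → ℝ) (i : ι) (a : ℝ) :
    ∑ j, f j (Function.update α i a j) = ∑ j, f j (α j) + (f i a - f i (α i)) := by
  rw [← sub_eq_iff_eq_add', ← Finset.sum_sub_distrib, Finset.sum_eq_single i]
  · simp
  · intro j _ hj
    simp [hj]
  · simp

/-- The effect on the dual objective of changing one coordinate. -/
theorem dual_update {E : Type*} [NormedAddCommGroup E] [InnerProductSpace ℝ E]
    {N : ℕ} (hN : 1 ≤ N) (x : Fin N → E) (l : Fin N → ℝ → ℝ) {lam : ℝ} (hlam : 0 < lam)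
    (α : Fin N → ℝ) {w : E} (hw : w = (1 / (lam * (N : ℝ))) • ∑ j, α j • x j)
    (i : Fin N) (d : ℝ) :
    dual N x l lam (Function.update α i (α i + d)) = dual N x l lam α
      + (1 / (N : ℝ)) * (conj (l i) (-(α i)) - conj (l i) (-(α i + d)) - d * ⟪x i, w⟫)
      - d ^ 2 * ‖x i‖ ^ 2 / (2 * lam * (N : ℝ) ^ 2) := by
  have hN' : (0 : ℝ) < N := by exact_mod_cast hN
  have h₁ : (1 / (lam * (N : ℝ))) • ∑ j, Function.update α i (α i + d) j • x j
      = w + (d / (lam * N)) • x i := by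
    rw [sum_update_apply (fun j a => a • x j), ← sub_smul, add_sub_cancel_left, smul_add, ← hw,
      smul_smul, one_div_mul_eq_div]
  have h₂ := sum_update_apply (fun j a => conj (l j) (-a)) α i (α i + d)
  have h₃ : ‖w + (d / (lam * N)) • x i‖ ^ 2
      = ‖w‖ ^ 2 + 2 * (d / (lam * N) * ⟪x i, w⟫) + (d / (lam * N)) ^ 2 * ‖x i‖ ^ 2 := by
    rw [norm_add_sq_real, inner_smul_right, real_inner_comm, norm_smul, mul_pow,
      Real.norm_eq_abs, sq_abs]
  unfold dual
  rw [h₁, h₂, h₃, ← hw]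
  field_simp
  ring

/-- The duality gap at `w = w(α)` as a sum of the coordinatewise Fenchel–Young gaps. -/
theorem primal_sub_dual {E : Type*} [NormedAddCommGroup E] [InnerProductSpace ℝ E]
    {N : ℕ} (hN : 1 ≤ N) (x : Fin N → E) (l : Fin N → ℝ → ℝ) {lam : ℝ} (hlam : 0 < lam)
    (α : Fin N → ℝ) {w : E} (hw : w = (1 / (lam * (N : ℝ))) • ∑ j, α j • x j) :
    primal N x l lam w - dual N x l lam α
      = (1 / (N : ℝ)) * ∑ i, (l i ⟪x i, w⟫ + conj (l i) (-(α i)) + α i * ⟪x i, w⟫) := by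
  have hN' : (0 : ℝ) < N := by exact_mod_cast hN
  have h : ∑ i, α i * ⟪x i, w⟫ = lam * N * ‖w‖ ^ 2 := by
    have h₁ : ∑ j, α j • x j = (lam * N) • w := by
      rw [hw, smul_smul, mul_one_div_cancel (by positivity), one_smul]
    simp_rw [← real_inner_smul_left]
    rw [← sum_inner, h₁, real_inner_smul_left, real_inner_self_eq_norm_sq]
  unfold primal dual
  rw [← hw, Finset.sum_add_distrib, Finset.sum_add_distrib, h]
  field_simp
  ring

/-- Theorem 1's expected one-step inequality, written as an average over the `N`
equally likely single-coordinate updates, with `G` bounded by `2L²/λ`. -/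
theorem stmt3 {E : Type*} [NormedAddCommGroup E] [InnerProductSpace ℝ E]
    (N : ℕ) (hN : 1 ≤ N) (x : Fin N → E) (hx : ∀ i, ‖x i‖ ≤ 1)
    (l : Fin N → ℝ → ℝ) (lam : ℝ) (hlam : 0 < lam) (L : ℝ)
    (hconv : ∀ i, ConvexOn ℝ Set.univ (l i))
    (hLip : ∀ i, ∀ a b : ℝ, |l i a - l i b| ≤ L * |a - b|)
    (α : Fin N → ℝ) (hα : ∀ i, |α i| ≤ L)
    (hfin : ∀ i, BddAbove (Set.range fun z : ℝ => (-(α i)) * z - l i z))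
    (w : E) (hw : w = (1 / (lam * (N : ℝ))) • ∑ j, α j • x j)
    (u : Fin N → ℝ)
    (hu : ∀ i, ∀ y : ℝ, l i y ≥ l i ⟪x i, w⟫ - u i * (y - ⟪x i, w⟫))
    (s : ℝ) (hs : s ∈ Set.Icc (0 : ℝ) 1) :
    (1 / (N : ℝ)) * ∑ i, dual N x l lam (Function.update α i (α i + s * (u i - α i))) ≥
      dual N x l lam α + (s / (N : ℝ)) * (primal N x l lam w - dual N x l lam α)
        - (s ^ 2 / (N : ℝ)) * (2 * L ^ 2 / lam) := by
  have hN' : (1 : ℝ) ≤ N := by exact_mod_cast hN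
  have hN₀ : (0 : ℝ) < N := by linarith
  have step : ∀ i, dual N x l lam α
      + (s / N) * (l i ⟪x i, w⟫ + conj (l i) (-(α i)) + α i * ⟪x i, w⟫)
      - (s ^ 2 / N) * (2 * L ^ 2 / lam)
      ≤ dual N x l lam (Function.update α i (α i + s * (u i - α i))) := by
    intro i
    rw [dual_update hN x l hlam α hw]
    have hconj := mul_le_mul_of_nonneg_left (conj_neg_add_mul_sub_le (hfin i) (hu i) hs)
      (one_div_nonneg.2 hN₀.le)
    have hd : (u i - α i) ^ 2 ≤ (2 * L) ^ 2 := by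
      have hu' := abs_le.1 (abs_le_of_lipschitz_of_subgradient (hLip i) (hu i))
      have hα' := abs_le.1 (hα i)
      exact sq_le_sq' (by linarith) (by linarith)
    have herr : (s * (u i - α i)) ^ 2 * ‖x i‖ ^ 2 / (2 * lam * (N : ℝ) ^ 2)
        ≤ (s ^ 2 / N) * (2 * L ^ 2 / lam) :=
      calc (s * (u i - α i)) ^ 2 * ‖x i‖ ^ 2 / (2 * lam * (N : ℝ) ^ 2)
          ≤ s ^ 2 * (2 * L) ^ 2 * 1 / (2 * lam * (N : ℝ)) := by
            rw [mul_pow]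
            have := pow_le_one₀ (n := 2) (norm_nonneg _) (hx i)
            have := le_self_pow₀ hN' two_ne_zero
            gcongr
        _ = (s ^ 2 / N) * (2 * L ^ 2 / lam) := by
            field_simp
    rw [div_eq_mul_one_div s (N : ℝ)]
    linarith
  have hsum := Finset.sum_le_sum fun i (_ : i ∈ Finset.univ) => step i
  rw [Finset.sum_sub_distrib, Finset.sum_add_distrib, ← Finset.mul_sum] at hsum
  simp only [Finset.sum_const, Finset.card_univ, Fintype.card_fin, nsmul_eq_mul] at hsum
  rw [primal_sub_dual hN x l hlam α hw]
  refine le_of_eq_of_le ?_ (mul_le_mul_of_nonneg_left hsum (one_div_nonneg.2 hN₀.le))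
  field_simp
end

section
/- Let h be a real number with 0 ≤ h ≤ 1, and let a, t be natural numbers with 1 ≤ a ≤ t. Then ∏_{τ=a}^{t} (1 − h/τ) ≤ (a/(t+1))^h. -/
theorem one_sub_div_le_div_add_one_rpow {h x : ℝ} (hh : 0 ≤ h) (hx : 0 < x) :
    1 - h / x ≤ (x / (x + 1)) ^ h := by
  have hpos : 0 < x / (x + 1) := by positivity
  have hlog := Real.one_sub_inv_le_log_of_pos hpos
  have heq : 1 - (x / (x + 1))⁻¹ = -(1 / x) := by
    field_simp
    ring
  rw [heq] at hlog
  rw [Real.rpow_def_of_pos hpos]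
  have hexp := Real.add_one_le_exp (Real.log (x / (x + 1)) * h)
  have hmul := mul_le_mul_of_nonneg_right hlog hh
  have hdiv : -(1 / x) * h = -(h / x) := by ring
  linarith

/-- Product estimate used in the proof of Theorem 4: `∏_{τ=a}^t (1 − h/τ) ≤ (a/(t+1))^h`. -/
theorem stmt8 (h : ℝ) (hh0 : 0 ≤ h) (hh1 : h ≤ 1)
    (a t : ℕ) (ha : 1 ≤ a) (hat : a ≤ t) :
    ∏ τ ∈ Finset.Icc a t, (1 - h / (τ : ℝ)) ≤ ((a : ℝ) / ((t : ℝ) + 1)) ^ h := by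
  have ha' : (0 : ℝ) < a := by exact_mod_cast ha
  induction t, hat using Nat.le_induction with
  | base => simpa using one_sub_div_le_div_add_one_rpow hh0 ha'
  | succ n hn ih =>
    have hn' : (0 : ℝ) < ((n + 1 : ℕ) : ℝ) := by positivity
    have hfactor : 0 ≤ 1 - h / ((n + 1 : ℕ) : ℝ) := by
      have h1 : (1 : ℝ) ≤ ((n + 1 : ℕ) : ℝ) := by exact_mod_cast Nat.le_add_left 1 n
      rw [sub_nonneg, div_le_one hn']
      exact hh1.trans h1
    rw [Finset.prod_Icc_succ_top (by omega)]
    calc _ ≤ ((a : ℝ) / ((n : ℝ) + 1)) ^ h *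
          (((n + 1 : ℕ) : ℝ) / (((n + 1 : ℕ) : ℝ) + 1)) ^ h :=
          mul_le_mul ih (one_sub_div_le_div_add_one_rpow hh0 hn') hfactor (by positivity)
      _ = _ := by
          rw [← Real.mul_rpow (by positivity) (by positivity)]
          congr 1
          push_cast
          field_simp
end

section
/- Let h ∈ (0,1] be a real number and let C ≥ 2 and t ≥ C be natural numbers. Then ∑_{i=1}^{t−C+1} (1/i²)·((i + C)/(t + 1))^h ≤ (C + 1)·(ln(t − C + 1) + 1) / t^h. -/
theorem sum_Icc_one_div_le_log_add_one (n : ℕ) :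
    ∑ i ∈ Finset.Icc 1 n, 1 / (i : ℝ) ≤ Real.log n + 1 := by
  have h := harmonic_le_one_add_log n
  rw [harmonic_eq_sum_Icc] at h
  push_cast at h
  simp only [one_div]
  linarith

theorem one_div_sq_mul_rpow_div_le {h x c t : ℝ} (hh0 : 0 ≤ h) (hh1 : h ≤ 1)
    (hx : 1 ≤ x) (hc : 0 ≤ c) (ht : 0 < t) :
    1 / x ^ 2 * ((x + c) / (t + 1)) ^ h ≤ (c + 1) / t ^ h * (1 / x) := by
  have hth : 0 < t ^ h := Real.rpow_pos_of_pos ht h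
  calc 1 / x ^ 2 * ((x + c) / (t + 1)) ^ h
      ≤ 1 / x ^ 2 * ((x + c) / t) ^ h := by gcongr; linarith
    _ = 1 / x ^ 2 * ((x + c) ^ h / t ^ h) := by
        rw [Real.div_rpow (by linarith) ht.le]
    _ ≤ 1 / x ^ 2 * ((c + 1) * x / t ^ h) := by
        gcongr
        calc (x + c) ^ h ≤ (x + c) ^ (1 : ℝ) :=
              Real.rpow_le_rpow_of_exponent_le (by linarith) hh1
          _ = x + c := Real.rpow_one _
          _ ≤ (c + 1) * x := by nlinarith
    _ = (c + 1) / t ^ h * (1 / x) := by field_simp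

/-- Complete bound on the term `B₂` in the proof of Theorem 4. -/
theorem stmt10 (h : ℝ) (hh0 : 0 < h) (hh1 : h ≤ 1)
    (C t : ℕ) (hC : 2 ≤ C) (ht : C ≤ t) :
    ∑ i ∈ Finset.Icc 1 (t - C + 1),
        (1 / (i : ℝ) ^ 2) * (((i : ℝ) + (C : ℝ)) / ((t : ℝ) + 1)) ^ h ≤
      ((C : ℝ) + 1) * (Real.log ((t : ℝ) - (C : ℝ) + 1) + 1) / (t : ℝ) ^ h := by
  have ht0 : (0 : ℝ) < t := by exact_mod_cast (by lia : 0 < t)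
  calc _ ≤ ∑ i ∈ Finset.Icc 1 (t - C + 1), ((C : ℝ) + 1) / (t : ℝ) ^ h * (1 / (i : ℝ)) :=
        Finset.sum_le_sum fun i hi =>
          one_div_sq_mul_rpow_div_le hh0.le hh1
            (by exact_mod_cast (Finset.mem_Icc.mp hi).1) C.cast_nonneg ht0
    _ = ((C : ℝ) + 1) / (t : ℝ) ^ h * ∑ i ∈ Finset.Icc 1 (t - C + 1), 1 / (i : ℝ) := by
        rw [Finset.mul_sum]
    _ ≤ ((C : ℝ) + 1) / (t : ℝ) ^ h * (Real.log ((t - C + 1 : ℕ) : ℝ) + 1) := by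
        gcongr
        exact sum_Icc_one_div_le_log_add_one _
    _ = _ := by
        push_cast [Nat.cast_sub ht]
        ring
end

section
/- In the regularized ERM setting, let l_i be convex, let α ∈ ℝ^N with l_i*(−α_i) finite, set w = (1/(λN))·∑_{j=1}^N α_j x_j and z_i = ⟨x_i, w⟩, and let u_i ∈ ℝ be such that −u_i is a subgradient of l_i at z_i. Fix s ∈ [0,1] and set δ = s·(u_i − α_i). Then l_i*(−α_i − δ) is finite, and N·[D(α + δ·e_i) − D(α)] ≥ s·[ l_i(z_i) + l_i*(−α_i) + α_i·z_i ] − s²·(u_i − α_i)²/(2λN), where α + δ·e_i denotes α with δ added to its i-th coordinate. -/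
open scoped RealInnerProductSpace

/-- A convex combination of a point bounded by the conjugate and a point where Fenchel–Young
is an equality. -/
lemma mul_sub_le_of_subgradient {f : ℝ → ℝ} {a u z₀ s : ℝ}
    (hfin : BddAbove (Set.range fun z : ℝ => (-a) * z - f z))
    (hu : ∀ y : ℝ, f y ≥ f z₀ - u * (y - z₀)) (hs : s ∈ Set.Icc (0 : ℝ) 1) (z : ℝ) :
    (-a - s * (u - a)) * z - f z ≤ (1 - s) * conj f (-a) + s * (-u * z₀ - f z₀) := by
  have h₁ : (-a) * z - f z ≤ conj f (-a) := le_ciSup hfin z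
  have h₂ : -u * z - f z ≤ -u * z₀ - f z₀ := by linarith [hu z]
  have h₃ := mul_le_mul_of_nonneg_left h₁ (sub_nonneg.2 hs.2)
  have h₄ := mul_le_mul_of_nonneg_left h₂ hs.1
  linarith

lemma sum_update_add {ι M : Type*} [Fintype ι] [DecidableEq ι] [AddCommGroup M]
    (g : ι → ℝ → M) (α : ι → ℝ) (i : ι) (b : ℝ) :
    ∑ j, g j (Function.update α i b j) = ∑ j, g j (α j) + (g i b - g i (α i)) := by
  rw [← sub_eq_iff_eq_add', ← Finset.sum_sub_distrib, Finset.sum_eq_single i]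
  · simp
  · intro j _ hj
    simp [Function.update_of_ne hj]
  · simp

/-- Exact change of the dual objective under a single-coordinate update. -/
lemma dual_update_sub {E : Type*} [NormedAddCommGroup E] [InnerProductSpace ℝ E]
    {N : ℕ} (hN : 1 ≤ N) (x : Fin N → E) (l : Fin N → ℝ → ℝ) {lam : ℝ} (hlam : 0 < lam)
    (i : Fin N) (α : Fin N → ℝ) (δ : ℝ) :
    (N : ℝ) * (dual N x l lam (Function.update α i (α i + δ)) - dual N x l lam α) =
      -δ * ⟪x i, (1 / (lam * (N : ℝ))) • ∑ j, α j • x j⟫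
        - δ ^ 2 * ‖x i‖ ^ 2 / (2 * lam * (N : ℝ))
        - (conj (l i) (-(α i + δ)) - conj (l i) (-(α i))) := by
  have hN' : (N : ℝ) ≠ 0 := Nat.cast_ne_zero.2 (by omega)
  have hl := hlam.ne'
  unfold dual
  rw [sum_update_add (fun j b => b • x j), sum_update_add (fun j b => conj (l j) (-b)),
    ← sub_smul, add_sub_cancel_left, smul_add, norm_add_sq_real, smul_smul, inner_smul_right,
    norm_smul (_ * δ), mul_pow, Real.norm_eq_abs (_ * δ), sq_abs, real_inner_comm]
  field_simp
  ring

/-- Single-coordinate dual improvement inequality (key step in the proof of Theorem 1):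
the bracket is the `i`-th term of the primal-dual gap. -/
theorem stmt15 {E : Type*} [NormedAddCommGroup E] [InnerProductSpace ℝ E]
    (N : ℕ) (hN : 1 ≤ N) (x : Fin N → E) (hx : ∀ j, ‖x j‖ ≤ 1)
    (l : Fin N → ℝ → ℝ) (lam : ℝ) (hlam : 0 < lam)
    (i : Fin N) (hconv : ConvexOn ℝ Set.univ (l i))
    (α : Fin N → ℝ)
    (hfin : BddAbove (Set.range fun z : ℝ => (-(α i)) * z - l i z))
    (w : E) (hw : w = (1 / (lam * (N : ℝ))) • ∑ j, α j • x j)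
    (u : ℝ)
    (hu : ∀ y : ℝ, l i y ≥ l i ⟪x i, w⟫ - u * (y - ⟪x i, w⟫))
    (s : ℝ) (hs : s ∈ Set.Icc (0 : ℝ) 1) :
    BddAbove (Set.range fun z : ℝ => (-(α i) - s * (u - α i)) * z - l i z) ∧
    (N : ℝ) * (dual N x l lam (Function.update α i (α i + s * (u - α i)))
        - dual N x l lam α) ≥
      s * (l i ⟪x i, w⟫ + conj (l i) (-(α i)) + α i * ⟪x i, w⟫)
        - s ^ 2 * (u - α i) ^ 2 / (2 * lam * (N : ℝ)) := by
  have key := mul_sub_le_of_subgradient hfin hu hs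
  refine ⟨⟨_, Set.forall_mem_range.2 key⟩, ?_⟩
  have hconj : conj (l i) (-(α i) - s * (u - α i)) ≤ _ := ciSup_le key
  have hnorm : ‖x i‖ ^ 2 ≤ 1 := pow_le_one₀ (norm_nonneg _) (hx i)
  have hquad : (s * (u - α i)) ^ 2 * ‖x i‖ ^ 2 / (2 * lam * (N : ℝ)) ≤
      s ^ 2 * (u - α i) ^ 2 / (2 * lam * (N : ℝ)) := by
    rw [← mul_pow s]
    gcongr
    exact mul_le_of_le_one_right (sq_nonneg _) hnorm
  rw [dual_update_sub hN x l hlam, ← hw, neg_add']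
  linarith
end

section
/- Let y ∈ {−1, 1}, let μ > 0 (playing the role of λN), and let α, p ∈ ℝ. Define f(Δ) = y·(α + Δ) − Δ·p − Δ²/(2μ) on the feasible set S = {Δ ∈ ℝ : 0 ≤ y·(α + Δ) ≤ 1}, and set Δ* = y·min(1, max(0, y·α + μ·(1 − y·p))) − α. Then Δ* ∈ S and f(Δ) ≤ f(Δ*) for every Δ ∈ S. -/
/-- The variational inequality characterizing the projection of `u` onto `[0, 1]`. -/
theorem sub_clamp_mul_sub_clamp_nonpos {t : ℝ} (u : ℝ) (h0 : 0 ≤ t) (h1 : t ≤ 1) :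
    (t - min 1 (max 0 u)) * (u - min 1 (max 0 u)) ≤ 0 := by
  rcases le_total u 0 with hu | hu
  · rw [max_eq_left hu, min_eq_right zero_le_one]
    nlinarith
  · rw [max_eq_right hu]
    rcases le_total u 1 with hu1 | hu1
    · simp [min_eq_right hu1]
    · rw [min_eq_left hu1]
      nlinarith

/-- Closed-form solution of the local dual subproblem for the hinge loss (Section 5):
`Δ* = y·clamp(y·α + μ·(1 − y·p), 0, 1) − α` is feasible and maximizes
`f(Δ) = y·(α+Δ) − Δ·p − Δ²/(2μ)` over `S = {Δ : 0 ≤ y·(α+Δ) ≤ 1}`. -/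
theorem stmt17 (y μ α p : ℝ) (hy : y = -1 ∨ y = 1) (hμ : 0 < μ) :
    let Δs : ℝ := y * min 1 (max 0 (y * α + μ * (1 - y * p))) - α
    (0 ≤ y * (α + Δs) ∧ y * (α + Δs) ≤ 1) ∧
    ∀ Δ : ℝ, 0 ≤ y * (α + Δ) → y * (α + Δ) ≤ 1 →
      y * (α + Δ) - Δ * p - Δ ^ 2 / (2 * μ) ≤
        y * (α + Δs) - Δs * p - Δs ^ 2 / (2 * μ) := by
  intro Δs
  set u : ℝ := y * α + μ * (1 - y * p) with hu
  set c : ℝ := min 1 (max 0 u) with hc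
  have hyy : y * y = 1 := by rcases hy with rfl | rfl <;> norm_num
  have hΔs : Δs = y * c - α := rfl
  have hsc : y * (α + Δs) = c := by
    rw [hΔs]
    linear_combination c * hyy
  rw [hsc]
  refine ⟨⟨le_min zero_le_one (le_max_left _ _), min_le_left _ _⟩, fun Δ h0 h1 => ?_⟩
  have hvar := sub_clamp_mul_sub_clamp_nonpos u h0 h1
  rw [← hc] at hvar
  obtain ⟨t, ht⟩ : ∃ t, t = y * (α + Δ) := ⟨_, rfl⟩
  have hΔ : Δ = y * t - α := by
    rw [ht]
    linear_combination -(α + Δ) * hyy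
  rw [← ht] at hvar ⊢
  have key : (c - Δs * p - Δs ^ 2 / (2 * μ)) - (t - Δ * p - Δ ^ 2 / (2 * μ)) =
      ((t - c) ^ 2 - 2 * ((t - c) * (u - c))) / (2 * μ) := by
    rw [hΔ, hΔs, hu]
    field_simp
    linear_combination (t ^ 2 - c ^ 2) * hyy
  have hnonneg : 0 ≤ ((t - c) ^ 2 - 2 * ((t - c) * (u - c))) / (2 * μ) :=
    div_nonneg (by linarith [sq_nonneg (t - c)]) (by positivity)
  linarith
end
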